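/- Let D be a strongly connected balanced bipartite digraph of order 2a with a ≥ 2, such that d(u)+d(v) ≥ 3a+1 for every dominated pair {u,v} of vertices in D. Then D is Hamiltonian. -/

import Mathlib

open Finset Function

variable {V : Type*}

/-- Out-degree of a vertex in a digraph given by arc relation `A`. -/
noncomputable def outDeg (A : V → V → Prop) (u : V) : ℕ := {v | A u v}.ncard

/-- In-degree of a vertex. -/
noncomputable def inDeg (A : V → V → Prop) (u : V) : ℕ := {v | A v u}.ncard

/-- Degree `d(u) = d⁺(u) + d⁻(u)`. -/
noncomputable def deg (A : V → V → Prop) (u : V) : ℕ := outDeg A u + inDeg A u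

/-- Strong connectedness: a directed path between every ordered pair of vertices. -/
def StronglyConnected (A : V → V → Prop) : Prop :=
  ∀ u v : V, Relation.ReflTransGen A u v

/-- `X, Y` form a bipartition of the digraph `A`. -/
def IsBipartition (A : V → V → Prop) (X Y : Set V) : Prop :=
  Disjoint X Y ∧ X ∪ Y = Set.univ ∧
    ∀ u v, A u v → (u ∈ X ∧ v ∈ Y) ∨ (u ∈ Y ∧ v ∈ X)

/-- `{u,v}` is a dominating pair: a common out-neighbour exists. -/
def IsDominatingPair (A : V → V → Prop) (u v : V) : Prop :=
  u ≠ v ∧ ∃ w, A u w ∧ A v w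

/-- `{u,v}` is a dominated pair: a common in-neighbour exists. -/
def IsDominatedPair (A : V → V → Prop) (u v : V) : Prop :=
  u ≠ v ∧ ∃ w, A w u ∧ A w v

/-- The digraph contains a directed cycle of length `l`. -/
def HasCycleOfLength (A : V → V → Prop) (l : ℕ) : Prop :=
  ∃ f : ZMod l → V, Function.Injective f ∧ ∀ i, A (f i) (f (i + 1))

/-- The digraph contains a Hamiltonian (directed) cycle. -/
def IsHamiltonian [Fintype V] (A : V → V → Prop) : Prop :=
  ∃ f : ZMod (Fintype.card V) ≃ V, ∀ i, A (f i) (f (i + 1))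

/-- The digraph is exactly one directed cycle through all its vertices. -/
def IsDirectedCycleDigraph [Fintype V] (A : V → V → Prop) : Prop :=
  ∃ f : ZMod (Fintype.card V) ≃ V, ∀ u v, A u v ↔ ∃ i, u = f i ∧ v = f (i + 1)

/-- A balanced bipartite digraph of order `2a` is bipancyclic: it has cycles of
all even lengths `2, 4, …, 2a`. -/
def Bipancyclic [Fintype V] (A : V → V → Prop) (a : ℕ) : Prop :=
  ∀ l, 1 ≤ l → l ≤ a → HasCycleOfLength A (2 * l)

/-- A digraph is pancyclic: cycles of all lengths `2, …, n`. -/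
def Pancyclic [Fintype V] (A : V → V → Prop) : Prop :=
  ∀ l, 2 ≤ l → l ≤ Fintype.card V → HasCycleOfLength A l

/-- A cycle factor: a spanning collection of vertex-disjoint directed cycles,
i.e. a permutation `σ` with `v → σ v` an arc for every `v` (in a loopless
digraph all orbits have length `≥ 2`). -/
def HasCycleFactor (A : V → V → Prop) : Prop :=
  ∃ σ : Equiv.Perm V, ∀ v, A v (σ v)

/-- `arcs(S,T) = |A[S,T]| + |A[T,S]|`. -/
noncomputable def arcsCount (A : V → V → Prop) (S T : Set V) : ℕ :=
  {p : V × V | p.1 ∈ S ∧ p.2 ∈ T ∧ A p.1 p.2}.ncard +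
  {p : V × V | p.1 ∈ T ∧ p.2 ∈ S ∧ A p.1 p.2}.ncard

section

open scoped Classical

lemma outDeg_eq_card [Fintype V] (A : V → V → Prop) (u : V) :
    outDeg A u = #{v | A u v} := by
  rw [outDeg, Set.ncard_eq_toFinset_card', Set.toFinset_ofPred]

lemma inDeg_eq_card [Fintype V] (A : V → V → Prop) (u : V) :
    inDeg A u = #{v | A v u} := by
  rw [inDeg, Set.ncard_eq_toFinset_card', Set.toFinset_ofPred]

lemma deg_eq_sum [Fintype V] (A : V → V → Prop) (u : V) :
    deg A u = ∑ v, ((if A u v then 1 else 0) + (if A v u then 1 else 0)) := by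
  rw [deg, outDeg_eq_card, inDeg_eq_card, Finset.sum_add_distrib, Finset.card_filter,
    Finset.card_filter]

lemma outDeg_le [Fintype V] {A : V → V → Prop} {X : Finset V} {a : ℕ}
    (hA : ∀ u v, A u v → (u ∈ X ↔ v ∉ X)) (hX : #X = a) (hY : #Xᶜ = a) (u : V) :
    outDeg A u ≤ a := by
  rw [outDeg_eq_card]
  by_cases hu : u ∈ X
  · rw [← hY]
    refine Finset.card_le_card fun v hv => ?_
    simp only [Finset.mem_filter_univ] at hv
    simpa using (hA u v hv).1 hu
  · rw [← hX]
    refine Finset.card_le_card fun v hv => ?_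
    simp only [Finset.mem_filter_univ] at hv
    have := hA u v hv
    tauto

lemma inDeg_le [Fintype V] {A : V → V → Prop} {X : Finset V} {a : ℕ}
    (hA : ∀ u v, A u v → (u ∈ X ↔ v ∉ X)) (hX : #X = a) (hY : #Xᶜ = a) (u : V) :
    inDeg A u ≤ a :=
  outDeg_le (A := fun u v => A v u) (fun u v h => by have := hA v u h; tauto) hX hY u

lemma StronglyConnected.exists_out [Nontrivial V] {A : V → V → Prop}
    (h : StronglyConnected A) (u : V) : ∃ v, A u v := by
  obtain ⟨w, hw⟩ := exists_ne u
  rcases (h u w).cases_head with h1 | ⟨c, hc, -⟩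
  · exact absurd h1.symm hw
  · exact ⟨c, hc⟩

lemma StronglyConnected.exists_in [Nontrivial V] {A : V → V → Prop}
    (h : StronglyConnected A) (u : V) : ∃ v, A v u := by
  obtain ⟨w, hw⟩ := exists_ne u
  rcases (h w u).cases_tail with h1 | ⟨c, -, hc⟩
  · exact absurd h1.symm hw
  · exact ⟨c, hc⟩

/-- A set closed under in-neighbours in a strongly connected digraph is empty or everything. -/
lemma StronglyConnected.forall_of_closed {A : V → V → Prop} (h : StronglyConnected A)
    {P : V → Prop} (hP : ∀ u v, A u v → P v → P u) {v : V} (hv : P v) (u : V) : P u := by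
  induction h u v using Relation.ReflTransGen.head_induction_on with
  | refl => exact hv
  | head hab _ ih => exact hP _ _ hab ih

/-- Under the dominated-pair condition there is a cycle factor, or every vertex lies in a
dominated pair, or all vertices of one class but one have full degree. -/
lemma hasCycleFactor_or_forall_dominated_or_full [Fintype V] [Nontrivial V] {A : V → V → Prop}
    {X : Finset V} {a : ℕ}
    (hA : ∀ u v, A u v → (u ∈ X ↔ v ∉ X)) (hX : #X = a) (hY : #Xᶜ = a)
    (hsc : StronglyConnected A)
    (hdeg : ∀ u v : V, IsDominatedPair A u v → 3 * a + 1 ≤ deg A u + deg A v) :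
    HasCycleFactor A ∨ (∀ v, ∃ w, IsDominatedPair A v w) ∨
      ∃ u, ∀ w, w ≠ u → (w ∈ X ↔ u ∈ X) → 2 * a ≤ deg A w := by
  by_cases h1 : ∀ v, ∃ w, IsDominatedPair A v w
  · exact Or.inr (Or.inl h1)
  push Not at h1
  obtain ⟨v, hv⟩ := h1
  by_cases h2 : ∀ u w, A u w → (∀ z, ¬ IsDominatedPair A w z) → ∀ z, ¬ IsDominatedPair A u z
  · have hall := hsc.forall_of_closed (P := fun w => ∀ z, ¬ IsDominatedPair A w z) h2 hv
    left
    choose f hf using hsc.exists_out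
    have hsurj : Surjective f := fun w => by
      obtain ⟨u, hu⟩ := hsc.exists_in w
      refine ⟨u, ?_⟩
      by_contra hne
      exact hall _ _ ⟨hne, u, hf u, hu⟩
    exact ⟨Equiv.ofBijective f (Finite.surjective_iff_bijective.1 hsurj), hf⟩
  · push Not at h2
    obtain ⟨u, w, huw, hw, z, hz⟩ := h2
    refine Or.inr (Or.inr ⟨u, fun x hxu hx => ?_⟩)
    have hout : outDeg A u ≤ 1 := by
      rw [outDeg_eq_card, Finset.card_le_one]
      have key : ∀ p, A u p → p = w := fun p hp => by
        by_contra hne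
        exact hw p ⟨Ne.symm hne, u, huw, hp⟩
      intro p hp q hq
      simp only [Finset.mem_filter_univ] at hp hq
      rw [key p hp, key q hq]
    have hin := inDeg_le hA hX hY u
    have hd := hdeg u z hz
    have hz1 := outDeg_le hA hX hY z
    have hz2 := inDeg_le hA hX hY z
    have hina : a ≤ inDeg A u := by
      simp only [deg] at hd
      omega
    obtain ⟨y, hy⟩ := hsc.exists_in x
    have hyu : A y u := by
      rw [inDeg_eq_card] at hina
      by_cases hu : u ∈ X
      · have hsub : ({v | A v u} : Finset V) ⊆ Xᶜ := fun p hp => by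
          simp only [Finset.mem_filter_univ] at hp
          have := hA _ _ hp
          simp only [Finset.mem_compl]
          tauto
        have heq := Finset.eq_of_subset_of_card_le hsub (hY.trans_le hina)
        have hyX : y ∈ Xᶜ := by
          have := hA _ _ hy
          simp only [Finset.mem_compl]
          tauto
        rw [← heq] at hyX
        simpa using hyX
      · have hsub : ({v | A v u} : Finset V) ⊆ X := fun p hp => by
          simp only [Finset.mem_filter_univ] at hp
          have := hA _ _ hp
          tauto
        have heq := Finset.eq_of_subset_of_card_le hsub (hX.trans_le hina)
        have hyX : y ∈ X := by
          have := hA _ _ hy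
          tauto
        rw [← heq] at hyX
        simpa using hyX
    have := hdeg x u ⟨hxu, y, hy, hyu⟩
    have hu : deg A u ≤ a + 1 := by
      simp only [deg]
      omega
    omega

/-- Hall's condition for the out-neighbourhoods of the vertices of one class. -/
lemma card_le_card_outNeighbors [Fintype V] [Nontrivial V] {A : V → V → Prop}
    {X : Finset V} {a : ℕ}
    (hA : ∀ u v, A u v → (u ∈ X ↔ v ∉ X)) (hX : #X = a) (hY : #Xᶜ = a)
    (hsc : StronglyConnected A)
    (hdeg : ∀ u v : V, IsDominatedPair A u v → 3 * a + 1 ≤ deg A u + deg A v)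
    (hcase : (∀ v, ∃ w, IsDominatedPair A v w) ∨
      ∃ u, ∀ w, w ≠ u → (w ∈ X ↔ u ∈ X) → 2 * a ≤ deg A w)
    {S : Finset V} (hS : S ⊆ X) :
    #S ≤ #(S.biUnion fun u => {v | A u v}) := by
  by_contra! hlt
  set N : Finset V := S.biUnion fun u => {v | A u v} with hN
  have memN : ∀ {v}, v ∈ N ↔ ∃ u ∈ S, A u v := by simp [hN]
  have hNY : N ⊆ Xᶜ := fun v hv => by
    obtain ⟨u, hu, huv⟩ := memN.1 hv
    simpa using (hA u v huv).1 (hS hu)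
  have houtS : ∀ s ∈ S, outDeg A s ≤ #N := fun s hs => by
    rw [outDeg_eq_card]
    refine Finset.card_le_card fun v hv => ?_
    simp only [Finset.mem_filter_univ] at hv
    exact memN.2 ⟨s, hs, hv⟩
  have hN1 : 1 ≤ #N := by
    obtain ⟨s, hs⟩ := Finset.card_pos.1 (by omega : 0 < #S)
    obtain ⟨v, hv⟩ := hsc.exists_out s
    exact Finset.card_pos.2 ⟨v, memN.2 ⟨s, hs, hv⟩⟩
  have hSa : #S ≤ a := hX ▸ Finset.card_le_card hS
  have hT : #(Xᶜ \ N) = a - #N := by rw [Finset.card_sdiff_of_subset hNY, hY]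
  have hR : #(X \ S) = a - #S := by rw [Finset.card_sdiff_of_subset hS, hX]
  have memR : ∀ {t v}, t ∈ Xᶜ \ N → A v t → v ∈ X \ S := fun {t v} ht hv => by
    simp only [Finset.mem_sdiff, Finset.mem_compl] at ht ⊢
    have := hA v t hv
    exact ⟨by tauto, fun hvS => ht.2 (memN.2 ⟨v, hvS, hv⟩)⟩
  have hinT : ∀ t ∈ Xᶜ \ N, inDeg A t ≤ a - #S := fun t ht => by
    rw [inDeg_eq_card, ← hR]
    refine Finset.card_le_card fun v hv => ?_
    simp only [Finset.mem_filter_univ] at hv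
    exact memR ht hv
  have hR1 : 1 ≤ #(X \ S) := by
    obtain ⟨t, ht⟩ := Finset.card_pos.1 (by omega : 0 < #(Xᶜ \ N))
    obtain ⟨v, hv⟩ := hsc.exists_in t
    exact Finset.card_pos.2 ⟨v, memR ht hv⟩
  have hin := inDeg_le hA hX hY
  have hout := outDeg_le hA hX hY
  obtain ⟨s₁, hs₁, s₂, hs₂, hs⟩ := Finset.one_lt_card.1 (by omega : 1 < #S)
  rcases hcase with hdom | ⟨u, hu⟩
  · choose g hg using hsc.exists_in
    obtain ⟨t₁, ht₁, t₂, ht₂, hne, hgt⟩ :=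
      Finset.exists_ne_map_eq_of_card_lt_of_maps_to (by omega : #(X \ S) < #(Xᶜ \ N))
        (f := g) (fun t ht => memR ht (hg t))
    have h3 := hdeg t₁ t₂ ⟨hne, g t₁, hg t₁, hgt ▸ hg t₂⟩
    have h4 := hinT t₁ ht₁
    have h5 := hinT t₂ ht₂
    have h6 := hout t₁
    have h7 := hout t₂
    have hlow : ∀ v, a + 1 ≤ deg A v := fun v => by
      obtain ⟨w, hw⟩ := hdom v
      have h8 := hdeg v w hw
      have h9 := hin w
      have h10 := hout w
      simp only [deg] at h8 ⊢
      omega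
    have h11 := hlow s₁
    have h12 := hlow s₂
    have h13 := houtS s₁ hs₁
    have h14 := houtS s₂ hs₂
    have h15 := hin s₁
    have h16 := hin s₂
    simp only [deg] at h3 h11 h12
    by_cases hc : ∃ w, A w s₁ ∧ A w s₂
    · have h17 := hdeg s₁ s₂ ⟨hs, hc⟩
      simp only [deg] at h17
      omega
    · have h18 : inDeg A s₁ + inDeg A s₂ ≤ a := by
        rw [inDeg_eq_card, inDeg_eq_card, ← hY, ← Finset.card_union_of_disjoint]
        · refine Finset.card_le_card fun v hv => ?_
          simp only [Finset.mem_union, Finset.mem_filter_univ] at hv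
          have := hS hs₁
          have := hS hs₂
          have := hA v s₁
          have := hA v s₂
          simp only [Finset.mem_compl]
          tauto
        · rw [Finset.disjoint_left]
          intro w hw1 hw2
          simp only [Finset.mem_filter_univ] at hw1 hw2
          exact hc ⟨w, hw1, hw2⟩
      omega
  · by_cases huX : u ∈ X
    · obtain ⟨s, hs', hsu⟩ := Finset.exists_mem_ne (by omega : 1 < #S) u
      have h1 := hu s hsu (by simp [huX, hS hs'])
      have h2 := houtS s hs'
      have h3 := hin s
      simp only [deg] at h1
      omega
    · obtain ⟨t, ht, htu⟩ := Finset.exists_mem_ne (by omega : 1 < #(Xᶜ \ N)) u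
      have h1 := hu t htu (by
        have := (Finset.mem_sdiff.1 ht).1
        simp only [Finset.mem_compl] at this
        tauto)
      have h2 := hinT t ht
      have h3 := hout t
      simp only [deg] at h1
      omega

lemma hasCycleFactor_of_dominated [Fintype V] [Nontrivial V] {A : V → V → Prop}
    {X : Finset V} {a : ℕ}
    (hA : ∀ u v, A u v → (u ∈ X ↔ v ∉ X)) (hX : #X = a) (hY : #Xᶜ = a)
    (hsc : StronglyConnected A)
    (hdeg : ∀ u v : V, IsDominatedPair A u v → 3 * a + 1 ≤ deg A u + deg A v) :
    HasCycleFactor A := by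
  rcases hasCycleFactor_or_forall_dominated_or_full hA hX hY hsc hdeg with h | hcase
  · exact h
  have hall : ∀ S : Finset V, #S ≤ #(S.biUnion fun u => {v | A u v}) := fun S => by
    have h1 := card_le_card_outNeighbors hA hX hY hsc hdeg hcase
      (Finset.inter_subset_right : S ∩ X ⊆ X)
    have h2 := card_le_card_outNeighbors (X := Xᶜ)
      (fun u v h => by have := hA u v h; simp only [Finset.mem_compl]; tauto) hY
      (by rwa [compl_compl]) hsc hdeg
      (hcase.imp_right fun ⟨u, hu⟩ => ⟨u, fun w hw h => hu w hw (by
        simp only [Finset.mem_compl] at h; tauto)⟩)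
      (Finset.inter_subset_right : S ∩ Xᶜ ⊆ Xᶜ)
    have hdisj : Disjoint ((S ∩ X).biUnion fun u => ({v | A u v} : Finset V))
        ((S ∩ Xᶜ).biUnion fun u => {v | A u v}) := by
      rw [Finset.disjoint_left]
      intro w hw1 hw2
      simp only [Finset.mem_biUnion, Finset.mem_inter, Finset.mem_filter_univ,
        Finset.mem_compl] at hw1 hw2
      obtain ⟨u, ⟨-, hu⟩, huw⟩ := hw1
      obtain ⟨v, ⟨-, hv⟩, hvw⟩ := hw2
      have := hA u w huw
      have := hA v w hvw
      tauto
    have hS : (S ∩ X) ∪ (S ∩ Xᶜ) = S := by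
      rw [← Finset.inter_union_distrib_left, Finset.union_compl, Finset.inter_univ]
    have hScard : #(S ∩ X) + #(S ∩ Xᶜ) = #S := by
      rw [← Finset.card_union_of_disjoint, hS]
      exact Finset.disjoint_of_subset_left Finset.inter_subset_right
        (Finset.disjoint_of_subset_right Finset.inter_subset_right disjoint_compl_right)
    have hsub : ((S ∩ X).biUnion fun u => ({v | A u v} : Finset V)) ∪
        ((S ∩ Xᶜ).biUnion fun u => {v | A u v}) = S.biUnion fun u => {v | A u v} := by
      rw [← Finset.union_biUnion, hS]
    rw [← hsub, Finset.card_union_of_disjoint hdisj]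
    omega
  obtain ⟨f, hinj, hf⟩ := (Finset.all_card_le_biUnion_card_iff_exists_injective _).1 hall
  exact ⟨Equiv.ofBijective f (Finite.injective_iff_bijective.1 hinj), fun v => by
    simpa using hf v⟩

/-- Summing over a set invariant under a permutation. -/
lemma sum_comp_symm_of_invariant {σ : Equiv.Perm V} {C : Finset V}
    (hC : ∀ v, σ v ∈ C ↔ v ∈ C) (f : V → ℕ) : ∑ p ∈ C, f (σ.symm p) = ∑ p ∈ C, f p := by
  symm
  refine Finset.sum_bij (fun p _ => σ p) (fun p hp => (hC p).2 hp)
    (fun p _ q _ h => σ.injective h) (fun q hq => ⟨σ.symm q, ?_, by simp⟩) (fun p _ => by simp)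
  rw [← hC]
  simpa

/-- In an invariant set of a cycle factor both classes have the same size. -/
lemma card_filter_mem_eq_card_filter_notMem {A : V → V → Prop} {X : Finset V}
    (hA : ∀ u v, A u v → (u ∈ X ↔ v ∉ X)) {σ : Equiv.Perm V} (hσ : ∀ v, A v (σ v))
    {C : Finset V} (hC : ∀ v, σ v ∈ C ↔ v ∈ C) :
    #{v ∈ C | v ∈ X} = #{v ∈ C | v ∉ X} := by
  refine le_antisymm (Finset.card_le_card_of_injOn σ (fun v hv => ?_) σ.injective.injOn)
    (Finset.card_le_card_of_injOn σ (fun v hv => ?_) σ.injective.injOn)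
  all_goals
    have := hA _ _ (hσ v)
    simp only [Finset.coe_filter, Set.mem_ofPred_eq, hC] at hv ⊢
    tauto

/-- The number of the arcs `σ⁻¹ p → q` and `σ⁻¹ q → p` present in the digraph. -/
noncomputable def crossing (A : V → V → Prop) (σ : Equiv.Perm V) (p q : V) : ℕ :=
  (if A (σ.symm p) q then 1 else 0) + (if A (σ.symm q) p then 1 else 0)

lemma crossing_comm (A : V → V → Prop) (σ : Equiv.Perm V) (p q : V) :
    crossing A σ p q = crossing A σ q p := add_comm _ _

lemma sum_sum_crossing {A : V → V → Prop} {σ : Equiv.Perm V} {C D : Finset V}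
    (hC : ∀ v, σ v ∈ C ↔ v ∈ C) (hD : ∀ v, σ v ∈ D ↔ v ∈ D) :
    ∑ p ∈ C, ∑ q ∈ D, crossing A σ p q =
      ∑ p ∈ C, ∑ q ∈ D, ((if A p q then 1 else 0) + (if A q p then 1 else 0)) := by
  simp only [crossing, Finset.sum_add_distrib]
  congr 1
  · exact sum_comp_symm_of_invariant hC fun p => ∑ q ∈ D, if A p q then 1 else 0
  · exact Finset.sum_congr rfl fun p _ =>
      sum_comp_symm_of_invariant hD fun q => if A q p then 1 else 0

/-- Degrees over one side of an invariant bipartition, weighted by the crossing numbers. -/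
lemma sum_deg_mul_crossing_le [Fintype V] {A : V → V → Prop} {X : Finset V}
    (hA : ∀ u v, A u v → (u ∈ X ↔ v ∉ X)) {σ : Equiv.Perm V} (hσ : ∀ v, A v (σ v))
    {C D : Finset V} (hCD : IsCompl C D)
    (hC : ∀ v, σ v ∈ C ↔ v ∈ C) (hD : ∀ v, σ v ∈ D ↔ v ∈ D)
    (h1 : ∀ p ∈ C, ∀ q ∈ D, crossing A σ p q ≤ 1) :
    ∑ p ∈ C, ∑ q ∈ D, deg A p * crossing A σ p q ≤
      (2 * #{v ∈ C | v ∈ X} + #{v ∈ D | v ∈ X}) * ∑ p ∈ C, ∑ q ∈ D, crossing A σ p q := by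
  have hC2 := card_filter_mem_eq_card_filter_notMem hA hσ hC
  have hD2 := card_filter_mem_eq_card_filter_notMem hA hσ hD
  set c := #{v ∈ C | v ∈ X}
  set d := #{v ∈ D | v ∈ X}
  set t : V → ℕ := fun p => ∑ q ∈ D, ((if A p q then 1 else 0) + (if A q p then 1 else 0))
  have hdeg : ∀ p, deg A p ≤ 2 * c + t p := fun p => by
    have hsplit : deg A p = ∑ q ∈ C, ((if A p q then 1 else 0) + (if A q p then 1 else 0)) +
        t p := by
      rw [deg_eq_sum, ← Finset.sum_union hCD.disjoint]
      congr 1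
      exact hCD.sup_eq_top.symm
    have hle : ∑ q ∈ C, ((if A p q then 1 else 0) + (if A q p then 1 else 0)) ≤
        ∑ q ∈ C, if (p ∈ X ↔ q ∉ X) then 2 else 0 := by
      refine Finset.sum_le_sum fun q _ => ?_
      have := hA p q
      have := hA q p
      split_ifs <;> first | omega | tauto
    rw [← Finset.sum_filter, Finset.sum_const, smul_eq_mul] at hle
    by_cases hp : p ∈ X
    · simp only [hp, true_iff, ← hC2] at hle
      omega
    · simp only [hp, false_iff, not_not] at hle
      omega
  have hg : ∀ p ∈ C, ∑ q ∈ D, crossing A σ p q ≤ d := fun p hp => by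
    have hle : ∑ q ∈ D, crossing A σ p q ≤ ∑ q ∈ D, if (p ∈ X ↔ q ∈ X) then 1 else 0 := by
      refine Finset.sum_le_sum fun q hq => ?_
      split_ifs with h
      · exact h1 p hp q hq
      · have e1 := hA (σ.symm p) q
        have e2 := hA (σ.symm q) p
        have e3 := hA _ _ (hσ (σ.symm p))
        have e4 := hA _ _ (hσ (σ.symm q))
        simp only [Equiv.apply_symm_apply] at e3 e4
        rw [crossing, if_neg (by tauto), if_neg (by tauto)]
    rw [← Finset.sum_filter, Finset.sum_const, smul_eq_mul, mul_one] at hle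
    by_cases hp : p ∈ X
    · simpa only [hp, true_iff] using hle
    · simpa only [hp, false_iff, ← hD2] using hle
  have ht : ∑ p ∈ C, t p = ∑ p ∈ C, ∑ q ∈ D, crossing A σ p q := (sum_sum_crossing hC hD).symm
  calc ∑ p ∈ C, ∑ q ∈ D, deg A p * crossing A σ p q
      = ∑ p ∈ C, deg A p * ∑ q ∈ D, crossing A σ p q := by simp only [Finset.mul_sum]
    _ ≤ ∑ p ∈ C, (2 * c * ∑ q ∈ D, crossing A σ p q + d * t p) := by
        refine Finset.sum_le_sum fun p hp => ?_
        have := Nat.mul_le_mul_right (∑ q ∈ D, crossing A σ p q) (hdeg p)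
        have := Nat.mul_le_mul_left (t p) (hg p hp)
        nlinarith
    _ = (2 * c + d) * ∑ p ∈ C, ∑ q ∈ D, crossing A σ p q := by
        rw [Finset.sum_add_distrib, ← Finset.mul_sum, ← Finset.mul_sum, ht]
        ring

/-- Two parts of a cycle factor can be merged by exchanging the successors of two vertices. -/
lemma exists_exchange [Fintype V] {A : V → V → Prop} {X : Finset V} {a : ℕ}
    (hA : ∀ u v, A u v → (u ∈ X ↔ v ∉ X)) (hX : #X = a)
    (hsc : StronglyConnected A)
    (hdeg : ∀ u v : V, IsDominatedPair A u v → 3 * a + 1 ≤ deg A u + deg A v)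
    {σ : Equiv.Perm V} (hσ : ∀ v, A v (σ v)) {C : Finset V} (hC : ∀ v, σ v ∈ C ↔ v ∈ C)
    (hne : C.Nonempty) (hne' : Cᶜ.Nonempty) :
    ∃ u ∈ C, ∃ v ∉ C, A u (σ v) ∧ A v (σ u) := by
  by_contra! hno
  have hD : ∀ v, σ v ∈ Cᶜ ↔ v ∈ Cᶜ := fun v => by simp [hC]
  have hsymm : ∀ p, σ.symm p ∈ C ↔ p ∈ C := fun p => by rw [← hC]; simp
  have h1 : ∀ p ∈ C, ∀ q ∈ Cᶜ, crossing A σ p q ≤ 1 := fun p hp q hq => by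
    have := hno (σ.symm p) ((hsymm p).2 hp) (σ.symm q)
      (by rw [hsymm]; simpa using hq)
    simp only [Equiv.apply_symm_apply] at this
    rw [crossing]
    split_ifs <;> first | omega | tauto
  have hle1 := sum_deg_mul_crossing_le hA hσ isCompl_compl hC hD h1
  have hle2 := sum_deg_mul_crossing_le hA hσ isCompl_compl.symm hD hC
    (fun p hp q hq => crossing_comm A σ p q ▸ h1 q hq p hp)
  set c := #{v ∈ C | v ∈ X}
  set d := #{v ∈ Cᶜ | v ∈ X}
  set N := ∑ p ∈ C, ∑ q ∈ Cᶜ, crossing A σ p q with hN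
  have hcd : c + d = a := by
    have hdisj : Disjoint ({v ∈ C | v ∈ X} : Finset V) {v ∈ Cᶜ | v ∈ X} :=
      Finset.disjoint_filter_filter disjoint_compl_right
    rw [← hX, ← Finset.card_union_of_disjoint hdisj, ← Finset.filter_union, Finset.union_compl,
      Finset.filter_univ_mem]
  have hN' : ∑ p ∈ Cᶜ, ∑ q ∈ C, crossing A σ p q = N := by
    rw [Finset.sum_comm]
    exact Finset.sum_congr rfl fun p _ => Finset.sum_congr rfl fun q _ => crossing_comm A σ q p
  have hM : ∑ p ∈ Cᶜ, ∑ q ∈ C, deg A p * crossing A σ p q =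
      ∑ p ∈ C, ∑ q ∈ Cᶜ, deg A q * crossing A σ p q := by
    rw [Finset.sum_comm]
    exact Finset.sum_congr rfl fun p _ => Finset.sum_congr rfl fun q _ => by
      rw [crossing_comm A σ q p]
  rw [hN', hM] at hle2
  have hge : (3 * a + 1) * N ≤ ∑ p ∈ C, ∑ q ∈ Cᶜ, deg A p * crossing A σ p q +
      ∑ p ∈ C, ∑ q ∈ Cᶜ, deg A q * crossing A σ p q := by
    rw [hN, ← Finset.sum_add_distrib, Finset.mul_sum]
    refine Finset.sum_le_sum fun p hp => ?_
    rw [← Finset.sum_add_distrib, Finset.mul_sum]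
    refine Finset.sum_le_sum fun q hq => ?_
    rw [← add_mul]
    by_cases h0 : crossing A σ p q = 0
    · simp [h0]
    refine Nat.mul_le_mul_right _ (hdeg p q ⟨?_, ?_⟩)
    · rintro rfl
      exact (Finset.mem_compl.1 hq) hp
    · by_cases e1 : A (σ.symm p) q
      · exact ⟨σ.symm p, by simpa using hσ (σ.symm p), e1⟩
      · by_cases e2 : A (σ.symm q) p
        · exact ⟨σ.symm q, e2, by simpa using hσ (σ.symm q)⟩
        · simp [crossing, e1, e2] at h0
  have hpos : 0 < N := by
    have hex : ∃ u ∈ C, ∃ v ∉ C, A u v := by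
      by_contra! hcl
      obtain ⟨x, hx⟩ := hne
      obtain ⟨y, hy⟩ := hne'
      exact hsc.forall_of_closed (P := fun v => v ∉ C)
        (fun u v huv hv hu => hcl u hu v hv huv) (Finset.mem_compl.1 hy) x hx
    obtain ⟨u, hu, v, hv, huv⟩ := hex
    refine Finset.sum_pos' (fun _ _ => Nat.zero_le _) ⟨σ u, (hC u).2 hu, ?_⟩
    refine Finset.sum_pos' (fun _ _ => Nat.zero_le _) ⟨v, Finset.mem_compl.2 hv, ?_⟩
    simp [crossing, huv]
  have : (2 * c + d) * N + (2 * d + c) * N = 3 * a * N := by rw [← hcd]; ring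
  nlinarith

/-- Exchanging the successors of `u` and `v` joins the cycle of `v` to the cycle of `u`. -/
lemma pow_mem_of_exchange [Finite V] {σ : Equiv.Perm V} {u v : V} (huv : ¬ σ.SameCycle u v)
    {Z : Set V} (hZ : ∀ w ∈ Z, (σ * Equiv.swap u v) w ∈ Z) (hu : u ∈ Z) {w : V}
    (hw : σ.SameCycle v w) : w ∈ Z := by
  have hsucc : σ v ∈ Z := by simpa using hZ u hu
  have key : ∀ k : ℕ, (σ ^ (k + 1)) v ∈ Z := fun k => by
    induction k with
    | zero => simpa using hsucc
    | succ k ih =>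
      rw [pow_succ' σ (k + 1), Equiv.Perm.mul_apply]
      set x := (σ ^ (k + 1)) v with hx
      by_cases hxv : x = v
      · rwa [hxv]
      · have hxu : x ≠ u := fun h => huv (Equiv.Perm.SameCycle.symm ⟨(k + 1 : ℕ), by
          rw [zpow_natCast, ← hx, h]⟩)
        simpa [Equiv.swap_apply_of_ne_of_ne hxu hxv] using hZ x ih
  obtain ⟨k, hk, -, rfl⟩ := hw.exists_pow_eq''
  obtain ⟨k, rfl⟩ := Nat.exists_eq_add_of_lt hk
  simpa using key k

lemma exists_sameCycle_cycleFactor [Fintype V] [Nontrivial V] {A : V → V → Prop}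
    {X : Finset V} {a : ℕ}
    (hA : ∀ u v, A u v → (u ∈ X ↔ v ∉ X)) (hX : #X = a) (hY : #Xᶜ = a)
    (hsc : StronglyConnected A)
    (hdeg : ∀ u v : V, IsDominatedPair A u v → 3 * a + 1 ≤ deg A u + deg A v) :
    ∃ σ : Equiv.Perm V, (∀ v, A v (σ v)) ∧ ∃ r, ∀ v, σ.SameCycle r v := by
  obtain ⟨σ₀, hσ₀⟩ := hasCycleFactor_of_dominated hA hX hY hsc hdeg
  obtain ⟨r₀⟩ : Nonempty V := inferInstance
  have : Nonempty ({σ : Equiv.Perm V // ∀ v, A v (σ v)} × V) := ⟨⟨⟨σ₀, hσ₀⟩, r₀⟩⟩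
  obtain ⟨⟨⟨σ, hσ⟩, r⟩, hmax⟩ := Finite.exists_max
    fun x : {σ : Equiv.Perm V // ∀ v, A v (σ v)} × V => #{v | x.1.1.SameCycle x.2 v}
  refine ⟨σ, hσ, r, ?_⟩
  by_contra! hne
  obtain ⟨z, hz⟩ := hne
  obtain ⟨u, hu, v, hv, h1, h2⟩ := exists_exchange hA hX hsc hdeg hσ
    (C := {v | σ.SameCycle r v}) (fun v => by simp) ⟨r, by simp [Equiv.Perm.SameCycle.refl]⟩ ⟨z, by simpa using hz⟩
  simp only [Finset.mem_filter_univ] at hu hv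
  have huv : ¬ σ.SameCycle u v := fun h => hv (hu.trans h)
  have hτ : ∀ w, A w ((σ * Equiv.swap u v) w) := fun w => by
    by_cases hwu : w = u
    · simpa [hwu] using h1
    by_cases hwv : w = v
    · simpa [hwv] using h2
    · simpa [Equiv.swap_apply_of_ne_of_ne hwu hwv] using hσ w
  have hZ : ∀ w ∈ {w | (σ * Equiv.swap u v).SameCycle u w},
      (σ * Equiv.swap u v) w ∈ {w | (σ * Equiv.swap u v).SameCycle u w} := fun w hw =>
    Equiv.Perm.sameCycle_apply_right.2 hw
  have hjoin : ∀ w, σ.SameCycle v w → (σ * Equiv.swap u v).SameCycle u w := fun w hw =>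
    pow_mem_of_exchange huv hZ (Equiv.Perm.SameCycle.refl _ _) hw
  have hjoin' : ∀ w, σ.SameCycle u w → (σ * Equiv.swap u v).SameCycle u w := fun w hw =>
    pow_mem_of_exchange (u := v) (v := u) (fun h => huv h.symm)
      (by rwa [Equiv.swap_comm v u]) (hjoin v (Equiv.Perm.SameCycle.refl _ _)) hw
  refine absurd (hmax ⟨⟨σ * Equiv.swap u v, hτ⟩, u⟩) (not_le.2 (Finset.card_lt_card ?_))
  rw [Finset.ssubset_iff_of_subset]
  · exact ⟨v, by simpa using hjoin v (Equiv.Perm.SameCycle.refl _ _), by simpa using hv⟩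
  · intro w hw
    simp only [Finset.mem_filter_univ] at hw ⊢
    exact hjoin' w (hu.symm.trans hw)

/-- A cycle factor consisting of a single cycle is a Hamiltonian cycle. -/
lemma isHamiltonian_of_sameCycle [Fintype V] {A : V → V → Prop}
    {σ : Equiv.Perm V} (hσ : ∀ v, A v (σ v)) {r : V} (hr : ∀ v, σ.SameCycle r v) :
    IsHamiltonian A := by
  have hcyc : σ.IsCycleOn ((Finset.univ : Finset V) : Set V) := by
    rw [Finset.coe_univ]
    exact ⟨⟨fun _ _ => Set.mem_univ _, σ.injective.injOn, Set.surjOn_univ.2 σ.surjective⟩,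
      fun x _ y _ => (hr x).symm.trans (hr y)⟩
  have hpow : ∀ m n : ℕ, (σ ^ m) r = (σ ^ n) r ↔ m ≡ n [MOD Fintype.card V] := fun m n =>
    hcyc.pow_apply_eq_pow_apply (Finset.mem_univ r)
  have : NeZero (Fintype.card V) := ⟨(Fintype.card_pos_iff.2 ⟨r⟩).ne'⟩
  let f : ZMod (Fintype.card V) → V := fun i => (σ ^ i.val) r
  have hf : Injective f := fun i j hij => by
    have := (ZMod.natCast_eq_natCast_iff _ _ _).2 ((hpow _ _).1 hij)
    simpa using this
  have hbij : Bijective f :=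
    (Fintype.bijective_iff_injective_and_card f).2 ⟨hf, ZMod.card _⟩
  refine ⟨Equiv.ofBijective f hbij, fun i => ?_⟩
  have hstep : f (i + 1) = σ (f i) := by
    change (σ ^ (i + 1).val) r = σ ((σ ^ i.val) r)
    rw [← Equiv.Perm.mul_apply, ← pow_succ', hpow, ← ZMod.natCast_eq_natCast_iff]
    simp
  change A (f i) (f (i + 1))
  rw [hstep]
  exact hσ _

end

/-- `d(u)+d(v) ≥ 3a+1` on dominated pairs implies hamiltonicity. -/
theorem stmt_3 {V : Type*} [Fintype V] (A : V → V → Prop) (a : ℕ) (X Y : Set V)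
    (ha : 2 ≤ a) (hcard : Fintype.card V = 2 * a)
    (hbip : IsBipartition A X Y) (hX : X.ncard = a) (hY : Y.ncard = a)
    (hsc : StronglyConnected A)
    (hdeg : ∀ u v : V, IsDominatedPair A u v → 3 * a + 1 ≤ deg A u + deg A v) :
    IsHamiltonian A := by
  classical
  obtain ⟨hdisj, hun, harc⟩ := hbip
  have hXY : ∀ v, v ∈ Y ↔ v ∉ X := fun v => by
    have h1 : v ∈ X ∪ Y := hun ▸ Set.mem_univ v
    have h2 : v ∈ X → v ∉ Y := fun h => Set.disjoint_left.1 hdisj h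
    rw [Set.mem_union] at h1
    tauto
  have hX' : #X.toFinset = a := by rw [← hX, Set.ncard_eq_toFinset_card']
  have hY' : #X.toFinsetᶜ = a := by
    rw [Finset.card_compl, hX', hcard]
    omega
  have hA : ∀ u v, A u v → (u ∈ X.toFinset ↔ v ∉ X.toFinset) := fun u v h => by
    have := harc u v h
    simp only [hXY, Set.mem_toFinset] at this ⊢
    tauto
  have : Nontrivial V := Fintype.one_lt_card_iff_nontrivial.1 (by omega)
  obtain ⟨σ, hσ, r, hr⟩ := exists_sameCycle_cycleFactor hA hX' (by convert hY') hsc hdeg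
  exact isHamiltonian_of_sameCycle hσ hr
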